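/- For every point-shift F there exists a point-shift H (given by a measurable point-map h) such that for μ-almost every ω: H_ω is a bijection of ω, and for every x ∈ ω the two-sided H-orbit {H_ω^i(x) : i ∈ ℤ} of x equals the connected component C(x) of x in the functional graph G^F(ω). In particular H is a bijective point-shift that preserves the connected components of G^F(ω) and is dense in each of them. -/

import Mathlib

open Function Set MeasureTheory ProbabilityTheory
open scoped ENNReal NNReal

namespace PointShift

/-- Points of the grid `ℤ^d`. -/
abbrev Pt (d : ℕ) := Fin d → ℤ

/-- Configurations: subsets of the grid `ℤ^d`, identified with `{0,1}`-valued
functions, equipped with the product σ-algebra. -/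
abbrev Conf (d : ℕ) := Pt d → Bool

/-- The shift `θ_t ω = ω - t`. -/
def shift {d : ℕ} (t : Pt d) (ω : Conf d) : Conf d := fun x => ω (x + t)

/-- The support of a configuration, as a subset of `ℤ^d`. -/
def pts {d : ℕ} (ω : Conf d) : Set (Pt d) := {x | ω x = true}

/-- `g` is a point-map: it is measurable and selects a point of every
configuration having a point at the origin. -/
def IsPointMap {d : ℕ} (g : Conf d → Pt d) : Prop :=
  Measurable g ∧ ∀ ω : Conf d, ω 0 = true → ω (g ω) = true

/-- The point-shift associated with a point-map `g`: `F_ω x = x + g (θ_x ω)`. -/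
def Fps {d : ℕ} (g : Conf d → Pt d) (ω : Conf d) (x : Pt d) : Pt d :=
  x + g (shift x ω)

/-- `μ` is a stationary point process on the grid: a shift-invariant probability
measure with a point at the origin with positive probability. -/
def IsStationaryPP {d : ℕ} (μ : Measure (Conf d)) : Prop :=
  IsProbabilityMeasure μ ∧ (∀ t : Pt d, μ.map (shift t) = μ) ∧
    0 < μ {ω : Conf d | ω 0 = true}

/-- The Palm probability of `μ`: `μ` conditioned on having a point at the origin. -/
noncomputable def Palm {d : ℕ} (μ : Measure (Conf d)) : Measure (Conf d) :=
  μ[|{ω : Conf d | ω 0 = true}]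

/-- The foil of the point `x` in the configuration `ω`, for the point-shift of `g`. -/
def foilOn {d : ℕ} (g : Conf d → Pt d) (ω : Conf d) (x : Pt d) : Set (Pt d) :=
  {y | ω y = true ∧ ∃ n : ℕ, (Fps g ω)^[n] y = (Fps g ω)^[n] x}

/-- The connected component of the point `x` in the functional graph `G^F(ω)`. -/
def compOn {d : ℕ} (g : Conf d → Pt d) (ω : Conf d) (x : Pt d) : Set (Pt d) :=
  {y | ω y = true ∧ ∃ m n : ℕ, (Fps g ω)^[m] x = (Fps g ω)^[n] y}

/-- `K` is a directed cycle of the functional graph of `f`: a finite set of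
distinct points `c 0, …, c (k-1)` (with `k ≥ 1`) such that `f (c i) = c ((i+1) % k)`. -/
def IsCycle {X : Type*} (f : X → X) (K : Set X) : Prop :=
  ∃ (k : ℕ) (c : ℕ → X), 0 < k ∧
    (∀ i < k, ∀ j < k, c i = c j → i = j) ∧
    (∀ i < k, f (c i) = c ((i + 1) % k)) ∧
    K = c '' {i | i < k}

end PointShift

namespace PointShift

section FunctionalGraph

variable {X : Type*} (f : X → X) (r : X → X → Prop)

/-- `x` has ancestors of every order under `f`. -/
def IsCore (x : X) : Prop := ∀ n : ℕ, ∃ y, f^[n] y = x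

/-- No sibling of `x` (point with the same image) is above `x`. -/
def IsLastSibling (x : X) : Prop := ∀ z, f z = f x → ¬ r x z

/-- No sibling of `x` is below `x`. -/
def IsFirstSibling (x : X) : Prop := ∀ z, f z = f x → ¬ r z x

/-- `s` is the sibling immediately above `x`. -/
def IsNextSibling (x s : X) : Prop := f s = f x ∧ r x s ∧ ∀ z, f z = f x → r x z → ¬ r z s

/-- `l` is the childless point reached from `s` by repeatedly passing to the first child. -/
def IsLeftmostLeaf (l s : X) : Prop :=
  (∀ w, f w ≠ l) ∧ ∃ n : ℕ, f^[n] l = s ∧ ∀ i < n, IsFirstSibling f r (f^[i] l)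

/-- `y` follows `x` in the depth-first post-order traversal of the functional graph of `f`, with
siblings ordered by `r`. -/
def IsPostorderSucc (x y : X) : Prop :=
  (IsLastSibling f r x ∧ f x = y) ∨ ∃ s, IsNextSibling f r x s ∧ IsLeftmostLeaf f r y s

variable {f r}

theorem IsCore.map {x : X} (hx : IsCore f x) : IsCore f (f x) := fun n => by
  obtain ⟨y, hy⟩ := hx n
  exact ⟨f y, by rw [← iterate_succ_apply, iterate_succ_apply', hy]⟩

theorem exists_isCore_of_finite_fiber {x : X} (hfin : {y | f y = x}.Finite) (hx : IsCore f x) :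
    ∃ y, IsCore f y ∧ f y = x := by
  by_contra! hno
  have hex : ∀ y ∈ {y | f y = x}, ∃ n : ℕ, ∀ z, f^[n] z ≠ y := by
    intro y hy
    have : ¬ IsCore f y := fun h => hno y h hy
    simpa [IsCore] using this
  choose! n hn using hex
  obtain ⟨N, hN⟩ := (hfin.image n).bddAbove
  obtain ⟨z, hz⟩ := hx (N + 1)
  rw [iterate_succ_apply'] at hz
  have hle : n (f^[N] z) ≤ N := hN (mem_image_of_mem n hz)
  apply hn _ hz (f^[N - n (f^[N] z)] z)
  rw [← iterate_add_apply, Nat.add_sub_cancel' hle]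

theorem exists_forall_not_rel_of_finite [IsStrictOrder X r] {s : Set X} (hs : s.Finite)
    (hne : s.Nonempty) : ∃ m ∈ s, ∀ z ∈ s, ¬ r z m := by
  obtain ⟨m, hm, h⟩ := (Set.wellFoundedOn_iff.1 (hs.wellFoundedOn (r := r))).has_min s hne
  exact ⟨m, hm, fun z hz hr => h z hz ⟨hr, hz, hm⟩⟩

theorem IsPostorderSucc.exists_iterate_eq {x y : X} (h : IsPostorderSucc f r x y) :
    ∃ n : ℕ, f x = f^[n] y := by
  rcases h with ⟨-, h⟩ | ⟨s, hs, -, n, hn, -⟩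
  · exact ⟨0, h⟩
  · exact ⟨n + 1, by rw [iterate_succ_apply', hn, hs.1]⟩

/-- The post-order successor relation is invariant under isomorphisms of ordered functional
graphs. -/
theorem isPostorderSucc_equiv {Y : Type*} {f' : Y → Y} {r' : Y → Y → Prop} (e : Y ≃ X)
    (hf : ∀ y, e (f' y) = f (e y)) (hr : ∀ y z, r' y z ↔ r (e y) (e z)) (x y : Y) :
    IsPostorderSucc f' r' x y ↔ IsPostorderSucc f r (e x) (e y) := by
  have hit : ∀ (n : ℕ) z, e (f'^[n] z) = f^[n] (e z) := fun n z =>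
    (Semiconj.iterate_right (f := e) (ga := f') (gb := f) hf n) z
  have hfe : ∀ a b, f' a = b ↔ f (e a) = e b := fun a b => by rw [← hf, e.apply_eq_iff_eq]
  have hie : ∀ (n : ℕ) a b, f'^[n] a = b ↔ f^[n] (e a) = e b := fun n a b => by
    rw [← hit, e.apply_eq_iff_eq]
  simp only [IsPostorderSucc, IsLastSibling, IsNextSibling, IsLeftmostLeaf, IsFirstSibling, ne_eq,
    hfe, hie, hr, hf, hit, ← e.forall_congr_right (q := fun z => f z = f _ → _),
    ← e.exists_congr_right]
  simp only [← e.forall_congr_right]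

theorem isCore_equiv {Y : Type*} {f' : Y → Y} (e : Y ≃ X)
    (hf : ∀ y, e (f' y) = f (e y)) (y : Y) : IsCore f' y ↔ IsCore f (e y) := by
  have hie : ∀ (n : ℕ) a b, f'^[n] a = b ↔ f^[n] (e a) = e b := fun n a b => by
    rw [← (Semiconj.iterate_right (f := e) (ga := f') (gb := f) hf n) a, e.apply_eq_iff_eq]
  simp only [IsCore, hie, ← e.exists_congr_right]

variable [IsStrictTotalOrder X r]

theorem IsFirstSibling.eq {x y : X} (hx : IsFirstSibling f r x) (hy : IsFirstSibling f r y)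
    (h : f x = f y) : x = y :=
  Std.Trichotomous.trichotomous (r := r) x y (hy x h) (hx y h.symm)

theorem IsLastSibling.eq {x y : X} (hx : IsLastSibling f r x) (hy : IsLastSibling f r y)
    (h : f x = f y) : x = y :=
  Std.Trichotomous.trichotomous (r := r) x y (hx y h.symm) (hy x h)

theorem IsNextSibling.eq_right {x s t : X} (hs : IsNextSibling f r x s)
    (ht : IsNextSibling f r x t) : s = t :=
  Std.Trichotomous.trichotomous (r := r) s t (ht.2.2 s hs.1 hs.2.1) (hs.2.2 t ht.1 ht.2.1)

theorem IsNextSibling.eq_left {x y s : X} (hx : IsNextSibling f r x s)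
    (hy : IsNextSibling f r y s) : x = y :=
  Std.Trichotomous.trichotomous (r := r) x y
    (fun h => hx.2.2 y (hy.1.symm.trans hx.1) h hy.2.1)
    (fun h => hy.2.2 x (hx.1.symm.trans hy.1) h hx.2.1)

theorem IsLeftmostLeaf.eq_left {l l' s : X} (h : IsLeftmostLeaf f r l s)
    (h' : IsLeftmostLeaf f r l' s) : l = l' := by
  obtain ⟨hl, n, hn, hf⟩ := h
  obtain ⟨hl', n', hn', hf'⟩ := h'
  rw [← hn'] at hn
  clear hn'
  induction n generalizing n' with
  | zero =>
    cases n' with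
    | zero => exact hn
    | succ k => exact absurd ((iterate_succ_apply' f k l').symm.trans hn.symm) (hl _)
  | succ n ih =>
    cases n' with
    | zero => exact absurd ((iterate_succ_apply' f n l).symm.trans hn) (hl' _)
    | succ k =>
      rw [iterate_succ_apply', iterate_succ_apply'] at hn
      exact ih (fun i hi => hf i (by omega)) k ((hf n (by omega)).eq (hf' k (by omega)) hn)
        (fun i hi => hf' i (by omega))

theorem IsPostorderSucc.eq_right {x y z : X} (hy : IsPostorderSucc f r x y)
    (hz : IsPostorderSucc f r x z) : y = z := by
  rcases hy with ⟨hl, rfl⟩ | ⟨s, hs, hy⟩ <;> rcases hz with ⟨hl', hz⟩ | ⟨t, ht, hz⟩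
  · exact hz
  · exact absurd ht.2.1 (hl t ht.1)
  · exact absurd hs.2.1 (hl' s hs.1)
  · obtain rfl := hs.eq_right ht
    exact hy.eq_left hz

theorem IsPostorderSucc.eq_left {x x' y : X} (hx : IsPostorderSucc f r x y)
    (hx' : IsPostorderSucc f r x' y) : x = x' := by
  have key : ∀ {x s : X}, IsNextSibling f r x s → ∀ n n' : ℕ, f^[n] y = s →
      (∀ i < n', IsFirstSibling f r (f^[i] y)) → n' ≤ n := by
    intro x s hs n n' hn hf
    by_contra! hlt
    have := hf n hlt
    rw [hn] at this
    exact this x hs.1.symm hs.2.1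
  rcases hx with ⟨hl, hx⟩ | ⟨s, hs, hw, n, hn, hf⟩ <;>
    rcases hx' with ⟨hl', hx'⟩ | ⟨s', hs', hw', n', hn', hf'⟩
  · exact hl.eq hl' (hx.trans hx'.symm)
  · exact absurd hx (hw' x)
  · exact absurd hx' (hw x')
  · have hnn : n = n' := le_antisymm (key hs' n' n hn' hf) (key hs n n' hn hf')
    subst hnn
    obtain rfl := hn.symm.trans hn'
    exact hs.eq_left hs'

theorem isLastSibling_or_exists_isNextSibling (hfin : ∀ x, {y | f y = x}.Finite) (x : X) :
    IsLastSibling f r x ∨ ∃ s, IsNextSibling f r x s := by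
  by_cases hl : IsLastSibling f r x
  · exact Or.inl hl
  · right
    simp only [IsLastSibling, not_forall, not_not] at hl
    obtain ⟨z, hz, hxz⟩ := hl
    obtain ⟨s, hs, hmin⟩ := exists_forall_not_rel_of_finite (r := r)
      (s := {z | f z = f x ∧ r x z}) ((hfin (f x)).subset fun _ h => h.1) ⟨z, hz, hxz⟩
    exact ⟨s, hs.1, hs.2, fun z hz hr => hmin z ⟨hz, hr⟩⟩

theorem exists_isFirstSibling (hfin : ∀ x, {y | f y = x}.Finite) {s : X} (hs : ∃ w, f w = s) :
    ∃ c, f c = s ∧ IsFirstSibling f r c := by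
  obtain ⟨c, hc, hmin⟩ := exists_forall_not_rel_of_finite (r := r) (hfin s) hs
  exact ⟨c, hc, fun z hz => hmin z (hz.trans hc)⟩

theorem exists_isLeftmostLeaf (hfin : ∀ x, {y | f y = x}.Finite) {s : X} (hs : ¬ IsCore f s) :
    ∃ l, IsLeftmostLeaf f r l s := by
  simp only [IsCore, not_forall, not_exists] at hs
  obtain ⟨n, hn⟩ := hs
  induction n generalizing s with
  | zero => exact absurd rfl (hn s)
  | succ n ih =>
    by_cases hw : ∃ w, f w = s
    · obtain ⟨c, rfl, hc⟩ := exists_isFirstSibling (r := r) hfin hw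
      obtain ⟨l, hl, k, rfl, hk⟩ := ih (s := c) fun y hy => hn y (by rw [iterate_succ_apply', hy])
      refine ⟨l, hl, k + 1, iterate_succ_apply' f k l, fun i hi => ?_⟩
      rcases Nat.lt_succ_iff_lt_or_eq.1 hi with h | rfl
      exacts [hk i h, hc]
    · exact ⟨s, fun w h => hw ⟨w, h⟩, 0, rfl, fun i hi => absurd hi (Nat.not_lt_zero i)⟩

theorem exists_isPostorderSucc (hfin : ∀ x, {y | f y = x}.Finite)
    (hcore : ∀ x y, f x = f y → r x y → ¬ IsCore f y) (x : X) :
    ∃ y, IsPostorderSucc f r x y := by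
  rcases isLastSibling_or_exists_isNextSibling (r := r) hfin x with h | ⟨s, hs⟩
  · exact ⟨f x, Or.inl ⟨h, rfl⟩⟩
  · obtain ⟨l, hl⟩ := exists_isLeftmostLeaf (r := r) hfin (hcore x s hs.1.symm hs.2.1)
    exact ⟨l, Or.inr ⟨s, hs, hl⟩⟩

/-- If the traversal of the subtree of each later sibling `z` of `x` ends at `z`, then the
traversal goes from `x` to `f x`. -/
theorem reflTransGen_isPostorderSucc_of_siblings (hfin : ∀ x, {y | f y = x}.Finite) {x : X}
    (hsib : ∀ z, f z = f x → r x z → ∃ l, IsLeftmostLeaf f r l z ∧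
      Relation.ReflTransGen (IsPostorderSucc f r) l z) :
    Relation.ReflTransGen (IsPostorderSucc f r) x (f x) := by
  have hwf : {z | f z = f x}.WellFoundedOn (swap r) :=
    (hfin (f x)).wellFoundedOn
  refine hwf.induction (x := x) (P := fun z => (z = x ∨ r x z) →
    Relation.ReflTransGen (IsPostorderSucc f r) z (f x)) rfl ?_ (Or.inl rfl)
  intro y hy ih hxy
  rcases isLastSibling_or_exists_isNextSibling (r := r) hfin y with h | ⟨s, hs⟩
  · exact .single (Or.inl ⟨h, hy⟩)
  · have hsx : f s = f x := hs.1.trans hy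
    have hxs : r x s := by
      rcases hxy with rfl | hxy
      exacts [hs.2.1, _root_.trans hxy hs.2.1]
    obtain ⟨l, hl, hls⟩ := hsib s hsx hxs
    exact .head (Or.inr ⟨s, hs, hl⟩) (hls.trans (ih s hsx hs.2.1 (Or.inr hxs)))

theorem exists_reflTransGen_isPostorderSucc (hfin : ∀ x, {y | f y = x}.Finite) {s : X}
    (hs : ¬ IsCore f s) : ∃ l, IsLeftmostLeaf f r l s ∧
      Relation.ReflTransGen (IsPostorderSucc f r) l s := by
  have hs' := hs
  simp only [IsCore, not_forall, not_exists] at hs'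
  obtain ⟨n, hn⟩ := hs'
  induction n generalizing s with
  | zero => exact absurd rfl (hn s)
  | succ n ih =>
    have ih' : ∀ z, f z = s → ∃ l, IsLeftmostLeaf f r l z ∧
        Relation.ReflTransGen (IsPostorderSucc f r) l z := by
      rintro z rfl
      exact ih (fun h => hs h.map) fun y hy => hn y (by rw [iterate_succ_apply', hy])
    by_cases hw : ∃ w, f w = s
    · obtain ⟨c, rfl, hc⟩ := exists_isFirstSibling (r := r) hfin hw
      obtain ⟨l, ⟨hl, k, rfl, hk⟩, hlc⟩ := ih' c rfl
      refine ⟨l, ⟨hl, k + 1, iterate_succ_apply' f k l, fun i hi => ?_⟩, hlc.trans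
        (reflTransGen_isPostorderSucc_of_siblings hfin fun z hz _ => ih' z hz)⟩
      rcases Nat.lt_succ_iff_lt_or_eq.1 hi with h | rfl
      exacts [hk i h, hc]
    · exact ⟨s, ⟨fun w h => hw ⟨w, h⟩, 0, rfl, fun i hi => absurd hi (Nat.not_lt_zero i)⟩, .refl⟩

theorem reflTransGen_isPostorderSucc (hfin : ∀ x, {y | f y = x}.Finite)
    (hcore : ∀ x y, f x = f y → r x y → ¬ IsCore f y) (x : X) :
    Relation.ReflTransGen (IsPostorderSucc f r) x (f x) :=
  reflTransGen_isPostorderSucc_of_siblings hfin fun z hz hr =>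
    exists_reflTransGen_isPostorderSucc hfin (hcore x z hz.symm hr)

end FunctionalGraph

section Stationary

variable {d : ℕ}

/-- `F` is a measurable family of self-maps of the grid, commuting with the shifts. -/
structure IsCovariantMap (F : Conf d → Pt d → Pt d) : Prop where
  measurable_apply : ∀ x, Measurable fun ω => F ω x
  shift_add : ∀ t ω x, F (shift t ω) x + t = F ω (x + t)

theorem measurable_shift (t : Pt d) : Measurable (shift t : Conf d → Conf d) :=
  measurable_pi_lambda _ fun x => measurable_pi_apply (x + t)

theorem shift_shift (s t : Pt d) (ω : Conf d) : shift s (shift t ω) = shift (s + t) ω := by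
  funext x
  simp [shift, add_assoc]

theorem IsCovariantMap.fps {g : Conf d → Pt d} (hg : Measurable g) : IsCovariantMap (Fps g) where
  measurable_apply x := measurable_const.add (hg.comp (measurable_shift x))
  shift_add t ω x := by
    simp only [Fps, shift_shift]
    abel

theorem IsCovariantMap.fps_apply_zero {F : Conf d → Pt d → Pt d} (hF : IsCovariantMap F) :
    Fps (fun ω => F ω 0) = F := by
  funext ω x
  rw [Fps, add_comm, hF.shift_add, zero_add]

theorem IsCovariantMap.measurable_iterate {F : Conf d → Pt d → Pt d} (hF : IsCovariantMap F)
    (n : ℕ) (x : Pt d) : Measurable fun ω => (F ω)^[n] x := by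
  induction n with
  | zero => exact measurable_const
  | succ n ih =>
    simp only [iterate_succ_apply']
    have : Measurable fun p : Conf d × Pt d => F p.1 p.2 :=
      measurable_from_prod_countable_left hF.measurable_apply
    exact this.comp (measurable_id.prodMk ih)

variable {μ : Measure (Conf d)}

theorem encard_setOf_eq_tsum_indicator {α ι : Type*} (p : ι → α → Prop) (a : α) :
    ({i | p i a}.encard : ℝ≥0∞) = ∑' i, {a | p i a}.indicator (1 : α → ℝ≥0∞) a := by
  rw [← ENNReal.tsum_set_one, tsum_subtype {i | p i a} fun _ => (1 : ℝ≥0∞)]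
  rfl

theorem measurable_encard_setOf {α ι : Type*} [MeasurableSpace α] [Countable ι]
    {p : ι → α → Prop} (hp : ∀ i, Measurable (p i)) :
    Measurable fun a => ({i | p i a}.encard : ℝ≥0∞) := by
  simp only [encard_setOf_eq_tsum_indicator]
  exact Measurable.tsum fun i =>
    measurable_one.indicator (measurableSet_setOfPred.2 (hp i))

theorem lintegral_encard_setOf {α ι : Type*} [MeasurableSpace α] (ν : Measure α) [Countable ι]
    {p : ι → α → Prop} (hp : ∀ i, Measurable (p i)) :
    ∫⁻ a, ({i | p i a}.encard : ℝ≥0∞) ∂ν = ∑' i, ν {a | p i a} := by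
  simp only [encard_setOf_eq_tsum_indicator]
  rw [lintegral_tsum fun i =>
    (measurable_one.indicator (measurableSet_setOfPred.2 (hp i))).aemeasurable]
  exact tsum_congr fun i => lintegral_indicator_one (measurableSet_setOfPred.2 (hp i))

/-- The mass transport principle for a covariant random relation on the grid. -/
theorem lintegral_encard_eq_lintegral_encard (hinv : ∀ t : Pt d, μ.map (shift t) = μ)
    {K : Conf d → Pt d → Pt d → Prop} (hK : ∀ x y, Measurable fun ω => K ω x y)
    (hcov : ∀ t ω x y, K (shift t ω) x y ↔ K ω (x + t) (y + t)) :
    ∫⁻ ω, ({y | K ω 0 y}.encard : ℝ≥0∞) ∂μ = ∫⁻ ω, ({y | K ω y 0}.encard : ℝ≥0∞) ∂μ := by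
  rw [lintegral_encard_setOf μ fun y => hK 0 y, lintegral_encard_setOf μ fun y => hK y 0,
    ← (Equiv.neg (Pt d)).tsum_eq]
  refine tsum_congr fun y => ?_
  conv_lhs => rw [← hinv y]
  rw [Measure.map_apply (measurable_shift y) (measurableSet_setOfPred.2 (hK _ _))]
  simp [hcov]

theorem lintegral_encard_fiber (hinv : ∀ t : Pt d, μ.map (shift t) = μ)
    {F : Conf d → Pt d → Pt d} (hF : IsCovariantMap F)
    {V : Conf d → Pt d → Prop} (hV : ∀ x, Measurable fun ω => V ω x)
    (hcov : ∀ t ω x, V (shift t ω) x ↔ V ω (x + t)) :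
    ∫⁻ ω, ({y | V ω y ∧ F ω y = 0}.encard : ℝ≥0∞) ∂μ = μ {ω | V ω 0} := by
  rw [← lintegral_encard_eq_lintegral_encard hinv (K := fun ω x y => V ω x ∧ F ω x = y)
    (fun x y => (hV x).and ((hF.measurable_apply x).eq_const y))
    (fun t ω x y => by rw [hcov, ← hF.shift_add, add_left_inj]),
    ← lintegral_indicator_one (measurableSet_setOfPred.2 (hV 0))]
  refine lintegral_congr fun ω => ?_
  by_cases h : V ω 0 <;> simp [h]

theorem ae_forall_of_ae_zero (hinv : ∀ t : Pt d, μ.map (shift t) = μ) {P : Conf d → Pt d → Prop}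
    (hcov : ∀ t ω, P (shift t ω) 0 ↔ P ω t) (h : ∀ᵐ ω ∂μ, P ω 0) : ∀ᵐ ω ∂μ, ∀ x, P ω x := by
  rw [ae_all_iff]
  intro x
  have := ae_of_ae_map (measurable_shift x).aemeasurable ((hinv x).symm ▸ h)
  simpa only [hcov] using this

theorem IsCovariantMap.image_fiber {F : Conf d → Pt d → Pt d} (hF : IsCovariantMap F)
    {V : Conf d → Pt d → Prop} (hcov : ∀ t ω x, V (shift t ω) x ↔ V ω (x + t)) (t : Pt d)
    (ω : Conf d) :
    (· + t) '' {y | V (shift t ω) y ∧ F (shift t ω) y = 0} = {y | V ω y ∧ F ω y = t} := by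
  ext z
  constructor
  · rintro ⟨y, ⟨hy, h⟩, rfl⟩
    exact ⟨(hcov t ω y).1 hy, by rw [← hF.shift_add, h, zero_add]⟩
  · rintro ⟨hz, h⟩
    refine ⟨z - t, ⟨?_, ?_⟩, sub_add_cancel z t⟩
    · rwa [hcov, sub_add_cancel]
    · rw [← add_left_inj t, hF.shift_add, sub_add_cancel, h, zero_add]

theorem IsCovariantMap.encard_fiber {F : Conf d → Pt d → Pt d} (hF : IsCovariantMap F)
    {V : Conf d → Pt d → Prop} (hcov : ∀ t ω x, V (shift t ω) x ↔ V ω (x + t)) (t : Pt d)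
    (ω : Conf d) :
    {y | V (shift t ω) y ∧ F (shift t ω) y = 0}.encard = {y | V ω y ∧ F ω y = t}.encard := by
  rw [← hF.image_fiber hcov t ω, (add_left_injective t).encard_image]

variable [IsProbabilityMeasure μ]

theorem ae_finite_fiber (hinv : ∀ t : Pt d, μ.map (shift t) = μ)
    {F : Conf d → Pt d → Pt d} (hF : IsCovariantMap F) :
    ∀ᵐ ω ∂μ, ∀ x, {y | F ω y = x}.Finite := by
  have hV : ∀ x : Pt d, Measurable fun _ : Conf d => True := fun _ => measurable_const
  have hcov : ∀ (t : Pt d) (ω : Conf d) (x : Pt d), True ↔ True := fun _ _ _ => Iff.rfl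
  have h := lintegral_encard_fiber hinv hF (V := fun _ _ => True) hV hcov
  refine ae_forall_of_ae_zero hinv (fun t ω => ?_) ?_
  · have := hF.encard_fiber (V := fun _ _ => True) hcov t ω
    simp only [true_and] at this
    rw [← encard_lt_top_iff, this, encard_lt_top_iff]
  · simp only [true_and] at h
    filter_upwards [ae_lt_top (measurable_encard_setOf fun y => (hF.measurable_apply y).eq_const 0)
      (h.trans_ne (measure_ne_top _ _))] with ω hω
    rwa [ENat.toENNReal_lt_top, encard_lt_top_iff] at hω

/-- If every point of a covariant random set has a preimage in this set, then almost surely it has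
only one. -/
theorem ae_subsingleton_fiber (hinv : ∀ t : Pt d, μ.map (shift t) = μ)
    {F : Conf d → Pt d → Pt d} (hF : IsCovariantMap F)
    {V : Conf d → Pt d → Prop} (hV : ∀ x, Measurable fun ω => V ω x)
    (hcov : ∀ t ω x, V (shift t ω) x ↔ V ω (x + t))
    (hsurj : ∀ᵐ ω ∂μ, ∀ x, V ω x → ∃ y, V ω y ∧ F ω y = x) :
    ∀ᵐ ω ∂μ, ∀ x, {y | V ω y ∧ F ω y = x}.encard ≤ 1 := by
  refine ae_forall_of_ae_zero hinv (fun t ω => by rw [hF.encard_fiber hcov]) ?_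
  have hle : {ω | V ω 0}.indicator 1 ≤ᵐ[μ]
      fun ω => ({y | V ω y ∧ F ω y = 0}.encard : ℝ≥0∞) := by
    filter_upwards [hsurj] with ω hω
    by_cases h : V ω 0
    · have : (1 : ℕ∞) ≤ {y | V ω y ∧ F ω y = 0}.encard := one_le_encard_iff_nonempty.2 (hω 0 h)
      simpa [h] using ENat.toENNReal_le.2 this
    · simp [h]
  have hint := lintegral_indicator_one (μ := μ) (measurableSet_setOfPred.2 (hV 0))
  have := ae_eq_of_ae_le_of_lintegral_le hle (hint.trans_ne (measure_ne_top _ _))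
    (measurable_encard_setOf fun y =>
      (hV y).and ((hF.measurable_apply y).eq_const 0)).aemeasurable
    (by rw [hint, lintegral_encard_fiber hinv hF hV hcov])
  filter_upwards [this] with ω hω
  rw [← ENat.toENNReal_le, ← hω, ENat.toENNReal_one]
  exact indicator_le_self' (fun _ _ => zero_le) ω

theorem ae_surjective_of_ae_injective (hinv : ∀ t : Pt d, μ.map (shift t) = μ)
    {F : Conf d → Pt d → Pt d} (hF : IsCovariantMap F) (hinj : ∀ᵐ ω ∂μ, Injective (F ω)) :
    ∀ᵐ ω ∂μ, Surjective (F ω) := by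
  have hV : ∀ x : Pt d, Measurable fun _ : Conf d => True := fun _ => measurable_const
  have hcov : ∀ (t : Pt d) (ω : Conf d) (x : Pt d), True ↔ True := fun _ _ _ => Iff.rfl
  have h := lintegral_encard_fiber hinv hF (V := fun _ _ => True) hV hcov
  simp only [true_and, ofPred_true, measure_univ] at h
  refine ae_forall_of_ae_zero hinv (P := fun ω x => ∃ y, F ω y = x) (fun t ω => ?_) ?_
  · constructor
    · rintro ⟨y, hy⟩
      exact ⟨y + t, by rw [← hF.shift_add, hy, zero_add]⟩
    · rintro ⟨y, hy⟩
      exact ⟨y - t, by rw [← add_left_inj t, hF.shift_add, sub_add_cancel, hy, zero_add]⟩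
  · have hle : (fun ω => ({y | F ω y = 0}.encard : ℝ≥0∞)) ≤ᵐ[μ] fun _ => 1 := by
      filter_upwards [hinj] with ω hω
      rw [← ENat.toENNReal_one, ENat.toENNReal_le, encard_le_one_iff]
      exact fun a b ha hb => hω (ha.trans hb.symm)
    filter_upwards [ae_eq_of_ae_le_of_lintegral_le hle (h.trans_ne ENNReal.one_ne_top)
      aemeasurable_const (by simp [h])] with ω hω
    by_contra hno
    have : {y | F ω y = 0} = ∅ := eq_empty_of_forall_notMem fun y hy => hno ⟨y, hy⟩
    simp [this] at hω

end Stationary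

section Postorder

variable {d : ℕ}

/-- The lexicographic order on the grid, modified so that the points having ancestors of every order
come first. -/
def siblingLT (f : Pt d → Pt d) (x y : Pt d) : Prop :=
  (IsCore f x ∧ ¬ IsCore f y) ∨ ((IsCore f x ↔ IsCore f y) ∧ toLex x < toLex y)

instance (f : Pt d → Pt d) : IsStrictTotalOrder (Pt d) (siblingLT f) where
  irrefl a h := by
    rcases h with h | h
    exacts [h.2 h.1, lt_irrefl _ h.2]
  trans a b c hab hbc := by
    have : toLex a < toLex b → toLex b < toLex c → toLex a < toLex c := lt_trans
    unfold siblingLT at *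
    tauto
  trichotomous a b hab hba := by
    have : toLex a < toLex b ∨ a = b ∨ toLex b < toLex a := lt_trichotomy (toLex a) (toLex b)
    unfold siblingLT at *
    tauto

/-- The value related to `x` by the random relation `R`, if it is unique, and `x` otherwise. -/
noncomputable def selection (R : Conf d → Pt d → Pt d → Prop) (ω : Conf d) (x : Pt d) : Pt d :=
  open Classical in if h : ∃! y, R ω x y then h.choose else x

theorem selection_eq_iff {R : Conf d → Pt d → Pt d → Prop} {ω : Conf d} {x y : Pt d} :
    selection R ω x = y ↔ ((∃! z, R ω x z) ∧ R ω x y) ∨ ((¬ ∃! z, R ω x z) ∧ x = y) := by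
  unfold selection
  split_ifs with h
  · simp only [h, true_and, not_true_eq_false, false_and, or_false]
    exact ⟨fun hy => hy ▸ h.choose_spec.1, fun hy => h.unique h.choose_spec.1 hy⟩
  · simp [h]

theorem IsCovariantMap.selection {R : Conf d → Pt d → Pt d → Prop}
    (hR : ∀ x y, Measurable fun ω => R ω x y)
    (hcov : ∀ t ω x y, R (shift t ω) x y ↔ R ω (x + t) (y + t)) :
    IsCovariantMap (selection R) where
  measurable_apply x := by
    have hex : Measurable fun ω => ∃! z, R ω x z :=
      Measurable.exists fun z => (hR x z).and <|
        Measurable.forall fun w => (hR x w).imp measurable_const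
    refine measurable_to_countable' fun y => ?_
    have : (fun ω => PointShift.selection R ω x) ⁻¹' {y} =
        {ω | ((∃! z, R ω x z) ∧ R ω x y) ∨ ((¬ ∃! z, R ω x z) ∧ x = y)} := by
      ext ω
      exact selection_eq_iff
    rw [this]
    exact measurableSet_setOfPred.2 ((hex.and (hR x y)).or (hex.not.and measurable_const))
  shift_add t ω x := by
    have hex : (∃! z, R (shift t ω) x z) ↔ ∃! z, R ω (x + t) z := by
      simp only [hcov]
      exact (Equiv.addRight t).existsUnique_congr_right (q := fun z => R ω (x + t) z)
    symm
    rw [selection_eq_iff, ← hex, ← hcov, add_left_inj, ← selection_eq_iff]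

/-- The successor map of the post-order traversal of the random functional graph of `F`. -/
noncomputable def postorder (F : Conf d → Pt d → Pt d) : Conf d → Pt d → Pt d :=
  selection fun ω => IsPostorderSucc (F ω) (siblingLT (F ω))

theorem IsCovariantMap.measurable_isCore {F : Conf d → Pt d → Pt d} (hF : IsCovariantMap F)
    (x : Pt d) : Measurable fun ω => IsCore (F ω) x :=
  Measurable.forall fun n => Measurable.exists fun y => (hF.measurable_iterate n y).eq_const x

theorem IsCovariantMap.isCore_shift {F : Conf d → Pt d → Pt d} (hF : IsCovariantMap F)
    (t : Pt d) (ω : Conf d) (x : Pt d) : IsCore (F (shift t ω)) x ↔ IsCore (F ω) (x + t) :=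
  isCore_equiv (Equiv.addRight t) (fun y => hF.shift_add t ω y) x

theorem IsCovariantMap.postorder {F : Conf d → Pt d → Pt d} (hF : IsCovariantMap F) :
    IsCovariantMap (postorder F) := by
  have hlt : ∀ x y, Measurable fun ω => siblingLT (F ω) x y := fun x y =>
    ((hF.measurable_isCore x).and (hF.measurable_isCore y).not).or
      (((hF.measurable_isCore x).iff (hF.measurable_isCore y)).and measurable_const)
  have heq : ∀ x y, Measurable fun ω => F ω x = y := fun x y => (hF.measurable_apply x).eq_const y
  have hfib : ∀ x y, Measurable fun ω => F ω x = F ω y := fun x y =>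
    measurableSet_setOfPred.1 (measurableSet_eq_fun (hF.measurable_apply x) (hF.measurable_apply y))
  have hfirst : ∀ x, Measurable fun ω => IsFirstSibling (F ω) (siblingLT (F ω)) x := fun x =>
    Measurable.forall fun z => (hfib z x).imp (hlt z x).not
  have hfirst' : ∀ n x, Measurable fun ω =>
      IsFirstSibling (F ω) (siblingLT (F ω)) ((F ω)^[n] x) := by
    intro n x
    have : Measurable fun p : Conf d × Pt d => IsFirstSibling (F p.1) (siblingLT (F p.1)) p.2 :=
      measurable_from_prod_countable_left hfirst
    exact this.comp (measurable_id.prodMk (hF.measurable_iterate n x))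
  refine IsCovariantMap.selection (fun x y => ?_) fun t ω x y => ?_
  · refine Measurable.or (Measurable.and ?_ (heq x y)) (Measurable.exists fun s =>
      Measurable.and (Measurable.and (hfib s x) (Measurable.and (hlt x s) ?_))
        (Measurable.and ?_ ?_))
    · exact Measurable.forall fun z => (hfib z x).imp (hlt x z).not
    · exact Measurable.forall fun z => (hfib z x).imp ((hlt x z).imp (hlt z s).not)
    · exact Measurable.forall fun w => (heq w y).not
    · exact Measurable.exists fun n => ((hF.measurable_iterate n y).eq_const s).and <|
        Measurable.forall fun i => Measurable.imp measurable_const (hfirst' i y)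
  · refine isPostorderSucc_equiv (Equiv.addRight t) (fun y => hF.shift_add t ω y)
      (fun y z => ?_) x y
    simp only [siblingLT, hF.isCore_shift, Equiv.coe_addRight]
    have : toLex (y + t) < toLex (z + t) ↔ toLex y < toLex z :=
      add_lt_add_iff_right (toLex t)
    rw [this]

theorem exists_iterate_eq_iterate_postorder (F : Conf d → Pt d → Pt d) (ω : Conf d) (x : Pt d) :
    ∃ m n : ℕ, (F ω)^[m] x = (F ω)^[n] (postorder F ω x) := by
  rcases selection_eq_iff.1 (rfl : postorder F ω x = _) with h | h
  · obtain ⟨n, hn⟩ := h.2.exists_iterate_eq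
    exact ⟨1, n, hn⟩
  · exact ⟨0, 0, h.2⟩

theorem exists_iterate_eq_iterate_trans {X : Type*} {f : X → X} {x y z : X}
    (hxy : ∃ m n : ℕ, f^[m] x = f^[n] y) (hyz : ∃ m n : ℕ, f^[m] y = f^[n] z) :
    ∃ m n : ℕ, f^[m] x = f^[n] z := by
  obtain ⟨a, b, hab⟩ := hxy
  obtain ⟨m, n, hmn⟩ := hyz
  refine ⟨m + a, b + n, ?_⟩
  rw [iterate_add_apply, hab, ← iterate_add_apply, add_comm m b, iterate_add_apply, hmn,
    ← iterate_add_apply]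

/-- If `h` is injective, each `h x` lies in the component of `x` for `f` and each `f x` lies on the
forward orbit of `x` for `h`, then the orbits of `h` are the components of `f`. -/
theorem exists_iterate_iff_of_injective {X : Type*} {f h : X → X} (hinj : Injective h)
    (hcomp : ∀ x, ∃ m n : ℕ, f^[m] x = f^[n] (h x)) (hreach : ∀ x, ∃ n : ℕ, h^[n] x = f x)
    (x y : X) :
    (∃ n : ℕ, h^[n] x = y ∨ h^[n] y = x) ↔ ∃ m n : ℕ, f^[m] x = f^[n] y := by
  have hcomp' : ∀ (k : ℕ) x, ∃ m n : ℕ, f^[m] x = f^[n] (h^[k] x) := by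
    intro k x
    induction k with
    | zero => exact ⟨0, 0, rfl⟩
    | succ k ih =>
      rw [iterate_succ_apply']
      exact exists_iterate_eq_iterate_trans ih (hcomp _)
  have hreach' : ∀ (k : ℕ) x, ∃ n : ℕ, h^[n] x = f^[k] x := by
    intro k x
    induction k with
    | zero => exact ⟨0, rfl⟩
    | succ k ih =>
      obtain ⟨n, hn⟩ := ih
      obtain ⟨m, hm⟩ := hreach (f^[k] x)
      exact ⟨m + n, by rw [iterate_add_apply, hn, hm, iterate_succ_apply']⟩
  constructor
  · rintro ⟨n, rfl | rfl⟩
    · exact hcomp' n x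
    · obtain ⟨a, b, hab⟩ := hcomp' n y
      exact ⟨b, a, hab.symm⟩
  · rintro ⟨m, n, hmn⟩
    obtain ⟨a, ha⟩ := hreach' m x
    obtain ⟨b, hb⟩ := hreach' n y
    have hab : h^[a] x = h^[b] y := by rw [ha, hb, hmn]
    rcases le_total a b with hle | hle
    · refine ⟨b - a, Or.inr (hinj.iterate a ?_)⟩
      rw [← iterate_add_apply, Nat.add_sub_cancel' hle, hab]
    · refine ⟨a - b, Or.inl (hinj.iterate b ?_)⟩
      rw [← iterate_add_apply, Nat.add_sub_cancel' hle, hab]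

theorem ae_bijective_postorder {μ : Measure (Conf d)} [IsProbabilityMeasure μ]
    (hinv : ∀ t : Pt d, μ.map (shift t) = μ) {F : Conf d → Pt d → Pt d} (hF : IsCovariantMap F) :
    ∀ᵐ ω ∂μ, Bijective (postorder F ω) ∧ ∀ x y,
      (∃ n : ℕ, (postorder F ω)^[n] x = y ∨ (postorder F ω)^[n] y = x) ↔
        ∃ m n : ℕ, (F ω)^[m] x = (F ω)^[n] y := by
  have hfin := ae_finite_fiber hinv hF
  have hcore := ae_subsingleton_fiber hinv hF hF.measurable_isCore hF.isCore_shift <| by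
    filter_upwards [hfin] with ω hω x hx
    exact exists_isCore_of_finite_fiber (hω x) hx
  have hgood : ∀ᵐ ω ∂μ, Injective (postorder F ω) ∧
      ∀ x, ∃ n : ℕ, (postorder F ω)^[n] x = F ω x := by
    filter_upwards [hfin, hcore] with ω hfin hcore
    have hsib : ∀ x y, F ω x = F ω y → siblingLT (F ω) x y → ¬ IsCore (F ω) y := by
      intro x y hxy hlt hy
      have hx : IsCore (F ω) x := by
        unfold siblingLT at hlt
        tauto
      obtain rfl : x = y := encard_le_one_iff.1 (hcore (F ω y)) x y ⟨hx, hxy⟩ ⟨hy, rfl⟩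
      exact irrefl x hlt
    have hsucc : ∀ x y, IsPostorderSucc (F ω) (siblingLT (F ω)) x y ↔ postorder F ω x = y := by
      intro x y
      have hex : ∃! z, IsPostorderSucc (F ω) (siblingLT (F ω)) x z :=
        existsUnique_of_exists_of_unique (exists_isPostorderSucc hfin hsib x)
          fun _ _ h h' => h.eq_right h'
      rw [postorder, selection_eq_iff]
      simp [hex]
    refine ⟨fun x y hxy => ((hsucc x _).2 hxy).eq_left ((hsucc y _).2 rfl), fun x => ?_⟩
    have hreach := reflTransGen_isPostorderSucc hfin hsib x
    generalize F ω x = y at hreach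
    induction hreach with
    | refl => exact ⟨0, rfl⟩
    | tail _ hyz ih =>
      obtain ⟨n, hn⟩ := ih
      exact ⟨n + 1, by rw [iterate_succ_apply', hn, (hsucc _ _).1 hyz]⟩
  filter_upwards [hgood, ae_surjective_of_ae_injective hinv hF.postorder
    (hgood.mono fun _ h => h.1)] with ω hω hsurj
  exact ⟨⟨hω.1, hsurj⟩, exists_iterate_iff_of_injective hω.1
    (exists_iterate_eq_iterate_postorder F ω) hω.2⟩

/-- Setting a point-map to zero off the event of having a point at the origin makes the points
outside the configuration fixed and leaves the iterates at points of the configuration unchanged. -/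
theorem IsPointMap.iterate_fps_ite {g : Conf d → Pt d} (hg : IsPointMap g) (ω : Conf d) (n : ℕ)
    (x : Pt d) :
    (ω ((Fps (fun ω => if ω 0 then g ω else 0) ω)^[n] x) = ω x) ∧
      (ω x = true → (Fps (fun ω => if ω 0 then g ω else 0) ω)^[n] x = (Fps g ω)^[n] x) := by
  induction n with
  | zero => exact ⟨rfl, fun _ => rfl⟩
  | succ n ih =>
    simp only [iterate_succ_apply']
    set z := (Fps (fun ω => if ω 0 then g ω else 0) ω)^[n] x with hz
    have hzero : shift z ω 0 = ω z := by simp [shift]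
    cases hx : ω x with
    | true =>
      have hzx : shift z ω 0 = true := by rw [hzero, ih.1, hx]
      have hstep : Fps (fun ω => if ω 0 then g ω else 0) ω z = Fps g ω z := by simp [Fps, hzx]
      refine ⟨?_, fun _ => by rw [hstep, ih.2 hx]⟩
      rw [hstep, Fps, add_comm]
      exact hg.2 _ hzx
    | false =>
      have hzx : shift z ω 0 = false := by rw [hzero, ih.1, hx]
      refine ⟨?_, fun h => absurd h Bool.false_ne_true⟩
      simp only [Fps, hzx, Bool.false_eq_true, if_false, add_zero]
      rw [ih.1, hx]

end Postorder

end PointShift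

/-- For every point-shift `F` there is a bijective point-shift `H`
whose two-sided orbits are exactly the connected components of `G^F(ω)`. -/
theorem stmt_13 {d : ℕ} (hd : 0 < d)
    (μ : Measure (PointShift.Conf d)) [IsProbabilityMeasure μ]
    (hinv : ∀ t : PointShift.Pt d, μ.map (PointShift.shift t) = μ)
    (hpos : 0 < μ {ω : PointShift.Conf d | ω 0 = true})
    (g : PointShift.Conf d → PointShift.Pt d) (hg : PointShift.IsPointMap g) :
    ∃ h : PointShift.Conf d → PointShift.Pt d, PointShift.IsPointMap h ∧
      ∀ᵐ ω ∂μ,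
        Set.BijOn (PointShift.Fps h ω) (PointShift.pts ω) (PointShift.pts ω) ∧
        ∀ x : PointShift.Pt d, ω x = true →
          {y : PointShift.Pt d | ω y = true ∧ ∃ n : ℕ,
              (PointShift.Fps h ω)^[n] x = y ∨ (PointShift.Fps h ω)^[n] y = x} =
            PointShift.compOn g ω x := by
  set G : PointShift.Conf d → PointShift.Pt d := fun ω => if ω 0 then g ω else 0 with hG
  have hzero : Measurable fun ω : PointShift.Conf d => ω 0 := measurable_pi_apply 0
  have hmeas : Measurable G :=
    Measurable.ite (measurableSet_setOfPred.2 (hzero.eq_const true)) hg.1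
      measurable_const
  have hF := PointShift.IsCovariantMap.fps hmeas
  have hH := hF.postorder
  have hmem : ∀ (ω : PointShift.Conf d) (x : PointShift.Pt d),
      ω (PointShift.postorder (PointShift.Fps G) ω x) = ω x := by
    intro ω x
    obtain ⟨m, n, hmn⟩ :=
      PointShift.exists_iterate_eq_iterate_postorder (PointShift.Fps G) ω x
    rw [← (hg.iterate_fps_ite ω n _).1, ← hG, ← hmn, (hg.iterate_fps_ite ω m x).1]
  refine ⟨fun ω => PointShift.postorder (PointShift.Fps G) ω 0,
    ⟨hH.measurable_apply 0, fun ω hω => (hmem ω 0).trans hω⟩, ?_⟩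
  rw [hH.fps_apply_zero]
  filter_upwards [PointShift.ae_bijective_postorder hinv hF] with ω hω
  refine ⟨⟨fun x hx => (hmem ω x).trans hx, hω.1.1.injOn, fun y hy => ?_⟩, fun x hx => ?_⟩
  · obtain ⟨x, rfl⟩ := hω.1.2 y
    exact ⟨x, (hmem ω x).symm.trans hy, rfl⟩
  · ext y
    refine and_congr_right fun hy => ?_
    rw [hω.2 x y]
    refine exists_congr fun m => exists_congr fun n => ?_
    rw [(hg.iterate_fps_ite ω m x).2 hx, (hg.iterate_fps_ite ω n y).2 hy]
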